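/- [Maximal lemma] For every ε > 0 there is a constant C_ε such that the following holds for every w > 0, every measurable u : ℝ → ℝ with |u| ≤ 1, all measurable sets E, F ⊆ ℝ², and all δ, λ ∈ (0,1]. If ℛ ⊆ U is a collection of tiles that are pairwise incomparable under ≤ and such that every R ∈ ℛ satisfies |E ∩ {(x,y) : u(x) ∈ ω_R} ∩ R| ≥ δ·|R| and |F ∩ R| ≥ λ·|R|, then Σ_{R∈ℛ} |R| ≤ C_ε·|F|/(δ·λ^{1+ε}). -/

import Mathlib

open MeasureTheory Set Filter
open scoped Classical

noncomputable section

namespace Bateman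

/-- A tile: frequency scale `l` (the frequency interval has length `2^{-l}`), frequency
position `m` (the interval is `[m·2^{-l}, (m+1)·2^{-l})`, contained in `[-2,2]`),
spatial dyadic position `n` (the `x`-projection is `[n·w·2^l, (n+1)·w·2^l)`) and
vertical position `k`. -/
structure Tile where
  l : ℕ
  m : ℤ
  n : ℤ
  k : ℤ
  hlo : (-2 : ℝ) ≤ (m : ℝ) * (2:ℝ) ^ (-(l:ℤ))
  hhi : ((m : ℝ) + 1) * (2:ℝ) ^ (-(l:ℤ)) ≤ 2

noncomputable instance : DecidableEq Tile := Classical.decEq _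

namespace Tile

/-- Length of the frequency interval of a tile. -/
def freqLen (s : Tile) : ℝ := (2:ℝ) ^ (-(s.l:ℤ))

/-- Frequency interval `ω_s`. -/
def ω (s : Tile) : Set ℝ := Ico ((s.m : ℝ) * s.freqLen) (((s.m : ℝ) + 1) * s.freqLen)

/-- Center of `ω_s`; this is the slope of the long side of the tile. -/
def slope (s : Tile) : ℝ := ((s.m : ℝ) + 1/2) * s.freqLen

/-- Right half `ω_{s,1}` of `ω_s`. -/
def ω1 (s : Tile) : Set ℝ := Ico s.slope (((s.m : ℝ) + 1) * s.freqLen)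

/-- Left half `ω_{s,2}` of `ω_s`. -/
def ω2 (s : Tile) : Set ℝ := Ico ((s.m : ℝ) * s.freqLen) s.slope

/-- Length `L(s) = w·2^l` of the tile. -/
def len (w : ℝ) (s : Tile) : ℝ := w * 2 ^ s.l

/-- The spatial parallelogram of the tile: two vertical sides of length `w`, two long
sides of slope `c(ω_s)` and length `w·2^l`, `x`-projection a dyadic interval. -/
def rect (w : ℝ) (s : Tile) : Set (ℝ × ℝ) :=
  {p | p.1 ∈ Ico ((s.n : ℝ) * s.len w) (((s.n : ℝ) + 1) * s.len w) ∧
       p.2 - s.slope * p.1 ∈ Ico ((s.k : ℝ) * w) (((s.k : ℝ) + 1) * w)}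

/-- Area `|s| = w²·2^l` of the tile. -/
def area (w : ℝ) (s : Tile) : ℝ := w ^ 2 * 2 ^ s.l

/-- Center of the tile. -/
def center (w : ℝ) (s : Tile) : ℝ × ℝ :=
  (((s.n : ℝ) + 1/2) * s.len w,
   s.slope * (((s.n : ℝ) + 1/2) * s.len w) + ((s.k : ℝ) + 1/2) * w)

/-- Dilate `C·s` of the tile by a factor `C` about its center. -/
def dilate (w C : ℝ) (s : Tile) : Set (ℝ × ℝ) :=
  (fun p => s.center w + C • (p - s.center w)) '' s.rect w

/-- Order on tiles: `s ≤ s'` iff `s ⊆ 10·s'` and `ω_{s'} ⊆ ω_s`. -/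
def le (w : ℝ) (s s' : Tile) : Prop := s.rect w ⊆ s'.dilate w 10 ∧ s'.ω ⊆ s.ω

/-- The affine map taking the tile onto the unit square centered at the origin. -/
def unitMap (w : ℝ) (s : Tile) (p : ℝ × ℝ) : ℝ × ℝ :=
  ((p.1 - ((s.n : ℝ) + 1/2) * s.len w) / s.len w,
   (p.2 - s.slope * p.1 - ((s.k : ℝ) + 1/2) * w) / w)

end Tile

/-- The weight `χ(x) = (1 + |x|^{100})⁻¹` on `ℝ²`. -/
def chi (p : ℝ × ℝ) : ℝ := (1 + (p.1 ^ 2 + p.2 ^ 2) ^ (50:ℕ))⁻¹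

/-- `χ_s^{(1)} = |s|⁻¹·χ∘A_s`, the `L¹`-normalized version of `χ` adapted to the tile. -/
def chi1 (w : ℝ) (s : Tile) (p : ℝ × ℝ) : ℝ := (s.area w)⁻¹ * chi (s.unitMap w p)

/-- The density `dense(s) = ∫_{E_s} χ_s^{(1)}` where `E_s = {(x,y) ∈ E : u(x) ∈ ω_s}`. -/
def dens (w : ℝ) (u : ℝ → ℝ) (E : Set (ℝ × ℝ)) (s : Tile) : ℝ :=
  ∫ p in {p ∈ E | u p.1 ∈ s.ω}, chi1 w s p

/-- The upward density `udense(s) = sup{dense(s') : s ≤ s'}`. -/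
def udens (w : ℝ) (u : ℝ → ℝ) (E : Set (ℝ × ℝ)) (s : Tile) : ℝ :=
  sSup {x | ∃ s' : Tile, Tile.le w s s' ∧ x = dens w u E s'}

/-- `e(t) = exp(2πit)`. -/
def e (t : ℝ) : ℂ := Complex.exp (Complex.I * ((2 * Real.pi * t : ℝ) : ℂ))

/-- The multiplier `m̂_ω(ξ,η) = β̃(wη)·β_ω(ξ/η)` of a tile, where
`β_ω(x) = β(2^{l+c}(x − c(ω₁)))` and `c(ω₁) = (m + 3/4)·2^{-l}` is the center of the
right half of `ω`. -/
def mhat (β βt : ℝ → ℝ) (cc : ℕ) (w : ℝ) (s : Tile) (ξ : ℝ × ℝ) : ℝ :=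
  βt (w * ξ.2) * β ((2:ℝ) ^ (s.l + cc) * (ξ.1 / ξ.2 - ((s.m : ℝ) + 3/4) * s.freqLen))

/-- `φ_ω`, the inverse Fourier transform of `(m̂_ω)^{1/2}`. -/
def φω (β βt : ℝ → ℝ) (cc : ℕ) (w : ℝ) (s : Tile) (x : ℝ × ℝ) : ℂ :=
  ∫ ξ : ℝ × ℝ, e (x.1 * ξ.1 + x.2 * ξ.2) * ((Real.sqrt (mhat β βt cc w s ξ) : ℝ) : ℂ)

/-- The `L²`-normalized wave packet `φ_s(p) = |s|^{1/2}·φ_ω(p − c(s))`. -/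
def wp (β βt : ℝ → ℝ) (cc : ℕ) (w : ℝ) (s : Tile) (p : ℝ × ℝ) : ℂ :=
  ((Real.sqrt (s.area w) : ℝ) : ℂ) * φω β βt cc w s (p - s.center w)

/-- `⟨f,g⟩ = ∫ f·conj g`. -/
def inn (f g : ℝ × ℝ → ℂ) : ℂ := ∫ p : ℝ × ℝ, f p * (starRingEnd ℂ) (g p)

/-- The inverse Fourier transform of `ψ_s(θ) = ψ(L(s)·θ)`. -/
def psiCheck (ψ : ℝ → ℝ) (w : ℝ) (s : Tile) (t : ℝ) : ℂ :=
  ∫ θ : ℝ, e (t * θ) * ((ψ (s.len w * θ) : ℝ) : ℂ)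

/-- The transformed wave packet
`phi_s(x₁,x₂) = ∫ ψ̌_s(t)·φ_s(x₁ − t, x₂ − t·u(x₁)) dt`. -/
def phiT (β βt ψ : ℝ → ℝ) (cc : ℕ) (w : ℝ) (u : ℝ → ℝ) (s : Tile) (x : ℝ × ℝ) : ℂ :=
  ∫ t : ℝ, psiCheck ψ w s t * wp β βt cc w s (x.1 - t, x.2 - t * u x.1)

/-- Hypotheses on the bump function `β`: smooth, `[0,1]`-valued, `1` on `[-1,1]`,
vanishing outside `[-2,2]`, with smooth square root. -/
def IsBumpβ (β : ℝ → ℝ) : Prop :=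
  ContDiff ℝ (⊤ : ℕ∞) β ∧ (∀ x, β x ∈ Icc (0:ℝ) 1) ∧ (∀ x ∈ Icc (-1:ℝ) 1, β x = 1) ∧
  (∀ x : ℝ, 2 ≤ |x| → β x = 0) ∧ ContDiff ℝ (⊤ : ℕ∞) (fun x => Real.sqrt (β x))

/-- Hypotheses on the bump function `β̃`: smooth, `[0,1]`-valued, supported in
`[1/2,5/2]` and equal to `1` on `[1,2]`. -/
def IsBumpβt (βt : ℝ → ℝ) : Prop :=
  ContDiff ℝ (⊤ : ℕ∞) βt ∧ (∀ x, βt x ∈ Icc (0:ℝ) 1) ∧ (∀ x ∈ Icc (1:ℝ) 2, βt x = 1) ∧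
  (∀ x : ℝ, x ∉ Icc (1/2 : ℝ) (5/2) → βt x = 0)

/-- Hypotheses on the bump function `ψ`: smooth, `[0,1]`-valued, supported in
`[98/100, 102/100]` and equal to `1` on `[99/100, 101/100]`. -/
def IsBumpψ (ψ : ℝ → ℝ) : Prop :=
  ContDiff ℝ (⊤ : ℕ∞) ψ ∧ (∀ x, ψ x ∈ Icc (0:ℝ) 1) ∧
  (∀ x ∈ Icc (99/100 : ℝ) (101/100), ψ x = 1) ∧
  (∀ x : ℝ, x ∉ Icc (98/100 : ℝ) (102/100) → ψ x = 0)

/-- A tree: a finite set of tiles together with a top tile. -/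
structure Tree where
  tiles : Finset Tile
  top : Tile

/-- `T` is a tree: every tile of `T` lies below the top. -/
def Tree.IsTree (w : ℝ) (T : Tree) : Prop := ∀ s ∈ T.tiles, Tile.le w s T.top

/-- `T` is a `1`-tree: moreover `ω_{top(T)} ∩ ω_{s,1} = ∅` for all `s ∈ T`. -/
def Tree.IsOneTree (w : ℝ) (T : Tree) : Prop :=
  T.IsTree w ∧ ∀ s ∈ T.tiles, T.top.ω ∩ s.ω1 = ∅

/-- The maximal `1`-subtree `T₁` of a tree `T`. -/
def Tree.oneTiles (T : Tree) : Finset Tile :=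
  T.tiles.filter fun s => T.top.ω ∩ s.ω1 = ∅

/-- `(1/|top(T)|)·Σ_{s∈T}|⟨f,φ_s⟩|²`. -/
def energy (β βt : ℝ → ℝ) (cc : ℕ) (w : ℝ) (f : ℝ × ℝ → ℂ) (T : Tree) : ℝ :=
  (T.top.area w)⁻¹ * ∑ s ∈ T.tiles, ‖inn f (wp β βt cc w s)‖ ^ 2

/-- The size of a finite collection of tiles with respect to the set `F`:
the supremum over `1`-trees `T ⊆ S` of `(|top(T)|⁻¹·Σ_{s∈T}|⟨1_F,φ_s⟩|²)^{1/2}`. -/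
def size (β βt : ℝ → ℝ) (cc : ℕ) (w : ℝ) (F : Set (ℝ × ℝ)) (S : Finset Tile) : ℝ :=
  sSup (insert 0 {x | ∃ T : Tree, T.IsOneTree w ∧ T.tiles ⊆ S ∧
    x = Real.sqrt (energy β βt cc w (F.indicator fun _ => (1:ℂ)) T)})


/-- The projection of a tile onto the `x`-axis. -/
def Tile.proj (w : ℝ) (s : Tile) : Set ℝ :=
  Ico ((s.n : ℝ) * s.len w) (((s.n : ℝ) + 1) * s.len w)

/-- The points `x` of the projection of a tile with `u x ∈ ω_s`. -/
def Tile.dense (w : ℝ) (u : ℝ → ℝ) (s : Tile) : Set ℝ := s.proj w ∩ u ⁻¹' s.ω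

/-- The tile with the same frequency interval and projection at vertical position `0`. -/
def Tile.base (s : Tile) : Tile := { s with k := 0 }

theorem add_one_pow_succ_le (n r : ℕ) :
    (n + 1) ^ (r + 1) ≤ n ^ (r + 1) + (r + 1) * (n + 1) ^ r := by
  induction r with
  | zero => simp
  | succ r ih =>
    have h := Nat.mul_le_mul_left n ih
    have e1 : n * ((r + 1) * (n + 1) ^ r) ≤ (r + 1) * (n + 1) ^ (r + 1) := by
      rw [pow_succ]
      nlinarith [Nat.zero_le ((r + 1) * (n + 1) ^ r)]
    calc (n + 1) ^ (r + 1 + 1) = n * (n + 1) ^ (r + 1) + (n + 1) ^ (r + 1) := by ring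
      _ ≤ n * (n ^ (r + 1) + (r + 1) * (n + 1) ^ r) + (n + 1) ^ (r + 1) := by gcongr
      _ = n ^ (r + 1 + 1) + n * ((r + 1) * (n + 1) ^ r) + (n + 1) ^ (r + 1) := by ring
      _ ≤ n ^ (r + 1 + 1) + (r + 1) * (n + 1) ^ (r + 1) + (n + 1) ^ (r + 1) := by gcongr
      _ = _ := by ring

theorem card_pow_succ_le {ι : Type*} (f : ι → ℕ) (r : ℕ) (S : Finset ι) :
    S.card ^ (r + 1) ≤ (r + 1) * ∑ s ∈ S, (S.filter fun t => f t ≤ f s).card ^ r := by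
  induction S using Finset.induction_on_max_value f with
  | empty => simp
  | insert a S ha hmax ih =>
    rw [Finset.card_insert_of_notMem ha, Finset.sum_insert ha]
    have h1 : ((insert a S).filter fun t => f t ≤ f a) = insert a S := by
      apply Finset.filter_true_of_mem
      intro t ht
      rcases Finset.mem_insert.1 ht with rfl | h
      · exact le_rfl
      · exact hmax t h
    rw [h1, Finset.card_insert_of_notMem ha]
    have h2 : ∑ s ∈ S, (S.filter fun t => f t ≤ f s).card ^ r ≤
        ∑ s ∈ S, ((insert a S).filter fun t => f t ≤ f s).card ^ r := by
      gcongr with s hs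
      exact Finset.subset_insert _ _
    calc _ ≤ _ := add_one_pow_succ_le S.card r
      _ ≤ (r + 1) * (∑ s ∈ S, (S.filter fun t => f t ≤ f s).card ^ r)
          + (r + 1) * (S.card + 1) ^ r := by gcongr
      _ ≤ (r + 1) * (∑ s ∈ S, ((insert a S).filter fun t => f t ≤ f s).card ^ r)
          + (r + 1) * (S.card + 1) ^ r := by gcongr
      _ = _ := by ring

theorem card_filter_mem_eq_sum_indicator {X ι : Type*} (S : Finset ι)
    (A : ι → Set X) (x : X) :
    (((S.filter fun t => x ∈ A t).card : ℕ) : ENNReal) =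
      ∑ t ∈ S, (A t).indicator (fun _ => (1 : ENNReal)) x := by
  rw [Finset.card_filter]
  push_cast
  simp only [Set.indicator_apply]

section Counting

variable {X ι : Type*} [MeasurableSpace X]

theorem measurable_card_filter_mem (S : Finset ι) (A : ι → Set X)
    (hA : ∀ t, MeasurableSet (A t)) :
    Measurable fun x => (((S.filter fun t => x ∈ A t).card : ℕ) : ENNReal) := by
  simp_rw [card_filter_mem_eq_sum_indicator]
  exact Finset.measurable_sum _ fun t _ => measurable_const.indicator (hA t)

/-- A moment of a counting function is controlled by lower moments of the counting functions
of the sets of smaller level. -/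
theorem setLIntegral_card_pow_succ_le (μ : Measure X) (S : Finset ι) (A : ι → Set X)
    (hA : ∀ t, MeasurableSet (A t)) (lev : ι → ℕ) (J : Set X) (r : ℕ) :
    ∫⁻ x in J, (((S.filter fun t => x ∈ A t).card : ℕ) : ENNReal) ^ (r + 1) ∂μ ≤
      ((r + 1 : ℕ) : ENNReal) * ∑ t ∈ S, ∫⁻ x in A t ∩ J,
        ((((S.filter fun s => lev s ≤ lev t).filter fun s => x ∈ A s).card : ℕ) : ENNReal) ^ r
          ∂μ := by
  have hm : ∀ t, Measurable fun x =>
      ((((S.filter fun s => lev s ≤ lev t).filter fun s => x ∈ A s).card : ℕ) : ENNReal) ^ r :=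
    fun t => (measurable_card_filter_mem _ A hA).pow_const r
  have key : ∀ x, (((S.filter fun t => x ∈ A t).card : ℕ) : ENNReal) ^ (r + 1) ≤
      ((r + 1 : ℕ) : ENNReal) * ∑ t ∈ S, (A t).indicator (fun x =>
        ((((S.filter fun s => lev s ≤ lev t).filter fun s => x ∈ A s).card : ℕ) : ENNReal) ^ r)
          x := by
    intro x
    have h := card_pow_succ_le lev r (S.filter fun t => x ∈ A t)
    have h' : (((S.filter fun t => x ∈ A t).card : ℕ) : ENNReal) ^ (r + 1) ≤
        ((r + 1 : ℕ) : ENNReal) * ∑ s ∈ S.filter fun t => x ∈ A t,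
          ((((S.filter fun t => x ∈ A t).filter fun t => lev t ≤ lev s).card : ℕ) : ENNReal) ^ r
        := by exact_mod_cast h
    refine h'.trans (le_of_eq ?_)
    rw [Finset.sum_filter]
    simp only [Set.indicator_apply, Finset.filter_filter, and_comm]
  calc _ ≤ ∫⁻ x in J, ((r + 1 : ℕ) : ENNReal) * ∑ t ∈ S, (A t).indicator (fun x =>
        ((((S.filter fun s => lev s ≤ lev t).filter fun s => x ∈ A s).card : ℕ) : ENNReal) ^ r)
          x ∂μ := lintegral_mono key
    _ = _ := by
      rw [lintegral_const_mul, lintegral_finsetSum]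
      · congr 1
        refine Finset.sum_congr rfl fun t _ => ?_
        rw [lintegral_indicator (hA t), Measure.restrict_restrict (hA t)]
      · exact fun t _ => (hm t).indicator (hA t)
      · exact Finset.measurable_sum _ fun t _ => (hm t).indicator (hA t)

end Counting

/-- Nestedness of dyadic intervals. -/
theorem Ico_dyadic_subset {a x : ℝ} (ha : 0 < a) {n n' : ℤ} {d : ℕ}
    (h : x ∈ Ico (n * a) ((n + 1) * a))
    (h' : x ∈ Ico (n' * (a * 2 ^ d)) ((n' + 1) * (a * 2 ^ d))) :
    Ico (n * a) ((n + 1) * a) ⊆ Ico ((n' : ℝ) * (a * 2 ^ d)) ((n' + 1) * (a * 2 ^ d)) := by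
  have h1 : n' * 2 ^ d < n + 1 := by
    have : (n' * 2 ^ d : ℝ) < n + 1 := by
      refine lt_of_mul_lt_mul_right ?_ ha.le
      linarith [h.2, h'.1]
    exact_mod_cast this
  have h2 : n < (n' + 1) * 2 ^ d := by
    have : (n : ℝ) < (n' + 1) * 2 ^ d := by
      refine lt_of_mul_lt_mul_right ?_ ha.le
      linarith [h.1, h'.2]
    exact_mod_cast this
  have h3 : (n' * 2 ^ d : ℝ) ≤ n := by exact_mod_cast Int.lt_add_one_iff.1 h1
  have h4 : (n + 1 : ℝ) ≤ (n' + 1) * 2 ^ d := by exact_mod_cast Int.add_one_le_iff.2 h2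
  apply Ico_subset_Ico
  · nlinarith
  · nlinarith

namespace Tile

variable {w : ℝ} {s t : Tile}

theorem len_pos (hw : 0 < w) (s : Tile) : 0 < s.len w := by unfold len; positivity

theorem freqLen_pos (s : Tile) : 0 < s.freqLen := by unfold freqLen; positivity

theorem freqLen_mul_len (w : ℝ) (s : Tile) : s.freqLen * s.len w = w := by
  unfold freqLen len
  rw [zpow_neg, zpow_natCast]
  field_simp

theorem len_eq_of_le (w : ℝ) (h : s.l ≤ t.l) : t.len w = s.len w * 2 ^ (t.l - s.l) := by
  unfold len
  rw [mul_assoc, ← pow_add, Nat.add_sub_cancel' h]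

theorem freqLen_eq_of_le (h : s.l ≤ t.l) : s.freqLen = t.freqLen * 2 ^ (t.l - s.l) := by
  unfold freqLen
  rw [← zpow_natCast (2:ℝ) (t.l - s.l), ← zpow_add₀ two_ne_zero]
  congr 1
  push_cast [h]
  ring

theorem proj_subset (hw : 0 < w) (h : s.l ≤ t.l) {x : ℝ} (hs : x ∈ s.proj w)
    (ht : x ∈ t.proj w) : s.proj w ⊆ t.proj w := by
  unfold proj at *
  rw [len_eq_of_le w h] at *
  exact Ico_dyadic_subset (len_pos hw s) hs ht

theorem ω_subset (h : s.l ≤ t.l) {x : ℝ} (hs : x ∈ s.ω) (ht : x ∈ t.ω) : t.ω ⊆ s.ω := by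
  unfold ω at *
  rw [freqLen_eq_of_le h] at *
  exact Ico_dyadic_subset (freqLen_pos t) ht hs

theorem slope_mem_ω (s : Tile) : s.slope ∈ s.ω := by
  have := freqLen_pos s
  constructor <;> unfold slope <;> nlinarith

theorem measurableSet_proj (w : ℝ) (s : Tile) : MeasurableSet (s.proj w) := measurableSet_Ico

theorem measurableSet_dense (w : ℝ) {u : ℝ → ℝ} (hu : Measurable u) (s : Tile) :
    MeasurableSet (s.dense w u) := (measurableSet_proj w s).inter (hu measurableSet_Ico)

theorem volume_proj (w : ℝ) (s : Tile) : volume (s.proj w) = ENNReal.ofReal (s.len w) := by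
  unfold proj
  rw [Real.volume_Ico]
  congr 1
  ring

theorem measurableSet_rect (w : ℝ) (s : Tile) : MeasurableSet (s.rect w) := by
  have h : s.rect w = Prod.fst ⁻¹' s.proj w ∩
      (fun p : ℝ × ℝ => p.2 - s.slope * p.1) ⁻¹' Ico ((s.k : ℝ) * w) (((s.k : ℝ) + 1) * w) := rfl
  rw [h]
  exact (measurable_fst (measurableSet_proj w s)).inter
    ((by fun_prop : Measurable fun p : ℝ × ℝ => p.2 - s.slope * p.1) measurableSet_Ico)

theorem setLIntegral_rect_fst (w : ℝ) (s : Tile) {f : ℝ → ENNReal} (hf : Measurable f) :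
    ∫⁻ p in s.rect w, f p.1 = ENNReal.ofReal w * ∫⁻ x in s.proj w, f x := by
  rw [← lintegral_indicator (measurableSet_rect w s), Measure.volume_eq_prod,
    lintegral_prod (fun p => (s.rect w).indicator (fun p => f p.1) p)
      ((hf.comp measurable_fst).indicator (measurableSet_rect w s)).aemeasurable,
    ← lintegral_indicator (measurableSet_proj w s), ← lintegral_const_mul _
      (hf.indicator (measurableSet_proj w s))]
  congr 1
  ext x
  by_cases hx : x ∈ s.proj w
  · have : ∀ y, (s.rect w).indicator (fun p => f p.1) (x, y) =
        (Ico (s.k * w + s.slope * x) ((s.k + 1) * w + s.slope * x)).indicator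
          (fun _ => f x) y := by
      intro y
      simp only [Set.indicator_apply]
      congr 1
      simp only [rect, mem_ofPred_eq, mem_Ico, eq_iff_iff]
      have hx' := hx
      simp only [proj, mem_Ico] at hx'
      constructor
      · rintro ⟨-, h1, h2⟩; constructor <;> linarith
      · rintro ⟨h1, h2⟩; exact ⟨hx', by linarith, by linarith⟩
    simp_rw [this]
    rw [lintegral_indicator measurableSet_Ico, setLIntegral_const, Real.volume_Ico,
      Set.indicator_of_mem hx, mul_comm]
    congr 2
    ring
  · have : ∀ y, (s.rect w).indicator (fun p => f p.1) (x, y) = 0 := fun y =>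
      Set.indicator_of_notMem (fun h => hx h.1) _
    simp [this, hx]

theorem dilate_ten {p : ℝ × ℝ} (h1 : |p.1 - (s.center w).1| < 5 * s.len w)
    (h2 : |p.2 - s.slope * p.1 - ((s.k : ℝ) + 1/2) * w| < 5 * w) : p ∈ s.dilate w 10 := by
  rw [abs_lt] at h1 h2
  refine ⟨s.center w + (1/10 : ℝ) • (p - s.center w), ?_, ?_⟩
  · simp only [rect, center, mem_ofPred_eq, mem_Ico, Prod.fst_add, Prod.snd_add, Prod.smul_fst,
      Prod.smul_snd, Prod.fst_sub, Prod.snd_sub, smul_eq_mul] at *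
    refine ⟨⟨?_, ?_⟩, ?_, ?_⟩ <;> linarith
  · simp only [add_sub_cancel_left, smul_smul]
    norm_num

theorem le_of_mem_rect (hw : 0 < w) (hω : t.ω ⊆ s.ω) {p : ℝ × ℝ} (hs : p ∈ s.rect w)
    (ht : p ∈ t.rect w) : Tile.le w s t := by
  refine ⟨fun q hq => ?_, hω⟩
  have hfs := freqLen_pos s
  have hft := freqLen_pos t
  have hle : t.freqLen ≤ s.freqLen := by
    have := (Ico_subset_Ico_iff (by nlinarith)).1 hω
    nlinarith [this.1, this.2]
  have hlen : s.len w ≤ t.len w := by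
    have h1 := freqLen_mul_len w s
    have h2 := freqLen_mul_len w t
    have := len_pos hw s
    by_contra! h
    nlinarith
  have hslope := hω (slope_mem_ω t)
  have hd : |s.slope - t.slope| ≤ s.freqLen / 2 := by
    rw [abs_le]
    have := hslope.1
    have := hslope.2
    have : s.slope = (s.m + 1/2) * s.freqLen := rfl
    constructor <;> linarith
  obtain ⟨⟨s1, s2⟩, s3, s4⟩ := hs
  obtain ⟨⟨t1, t2⟩, t3, t4⟩ := ht
  obtain ⟨⟨q1, q2⟩, q3, q4⟩ := hq
  have hx : |q.1 - p.1| ≤ s.len w := by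
    rw [abs_le]; constructor <;> linarith
  have hxs : |(s.slope - t.slope) * (q.1 - p.1)| ≤ w / 2 := by
    rw [abs_mul]
    calc _ ≤ s.freqLen / 2 * s.len w := by gcongr
      _ = s.freqLen * s.len w / 2 := by ring
      _ = w / 2 := by rw [freqLen_mul_len]
  rw [abs_le] at hx hxs
  apply dilate_ten
  · simp only [center]
    rw [abs_lt]
    have := len_pos hw s
    constructor <;> linarith
  · rw [abs_lt]
    constructor <;> linarith

theorem l_le_of_ω_subset (h : t.ω ⊆ s.ω) : s.l ≤ t.l := by
  by_contra! hlt
  have hft := freqLen_pos t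
  have hfs := freqLen_pos s
  have := (Ico_subset_Ico_iff (by nlinarith)).1 h
  have hle : t.freqLen ≤ s.freqLen := by nlinarith [this.1, this.2]
  rw [freqLen_eq_of_le hlt.le] at hle
  have : (1:ℝ) < 2 ^ (s.l - t.l) := one_lt_pow₀ one_lt_two (by omega)
  nlinarith

theorem m_eq_of_ω_subset (h : t.ω ⊆ s.ω) (hl : t.l = s.l) : t.m = s.m := by
  have hft := freqLen_pos t
  have hfs := freqLen_pos s
  have hle : t.freqLen = s.freqLen := by unfold freqLen; rw [hl]
  have := (Ico_subset_Ico_iff (by nlinarith)).1 h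
  rw [hle] at this
  have h1 := le_of_mul_le_mul_right this.1 hfs
  have h2 := le_of_mul_le_mul_right this.2 hfs
  have h3 : (t.m : ℝ) = s.m := by linarith
  exact_mod_cast h3

theorem n_eq_of_proj_subset (hw : 0 < w) (h : s.proj w ⊆ t.proj w) (hl : t.l = s.l) :
    t.n = s.n := by
  have hs := len_pos hw s
  have hle : t.len w = s.len w := by unfold len; rw [hl]
  have := (Ico_subset_Ico_iff (by nlinarith)).1 h
  rw [hle] at this
  have h1 := le_of_mul_le_mul_right this.1 hs
  have h2 := le_of_mul_le_mul_right this.2 hs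
  have h3 : (t.n : ℝ) = s.n := by linarith
  exact_mod_cast h3

end Tile

/-- The elements of `T` of level at most `L` whose frequency interval is minimal
(equivalently, whose projection is maximal) for simultaneous nesting. -/
def minimalTiles (w : ℝ) (T : Finset Tile) (L : ℕ) : Finset Tile :=
  T.filter fun t => t.l ≤ L ∧
    ∀ t' ∈ T, t'.l ≤ L → t.proj w ⊆ t'.proj w → t'.ω ⊆ t.ω → t' = t

theorem filter_minimalTiles_subset (w : ℝ) (T : Finset Tile) {K L : ℕ} (h : K ≤ L) :
    ((minimalTiles w T L).filter fun t => t.l ≤ K) ⊆ minimalTiles w T K := by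
  intro t ht
  simp only [minimalTiles, Finset.mem_filter] at ht ⊢
  exact ⟨ht.1.1, ht.2, fun t' h' hK => ht.1.2.2 t' h' (hK.trans h)⟩

theorem exists_minimalTiles {w : ℝ} (hw : 0 < w) {T : Finset Tile} (hT : ∀ t ∈ T, t.k = 0)
    {L : ℕ} {t : Tile} (ht : t ∈ T) (hL : t.l ≤ L) :
    ∃ t' ∈ minimalTiles w T L, t.proj w ⊆ t'.proj w ∧ t'.ω ⊆ t.ω := by
  obtain ⟨t', ht', hmax⟩ := Finset.exists_max_image
    (T.filter fun t' => t'.l ≤ L ∧ t.proj w ⊆ t'.proj w ∧ t'.ω ⊆ t.ω) Tile.l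
    ⟨t, by simp [ht, hL]⟩
  simp only [Finset.mem_filter] at ht' hmax
  refine ⟨t', ?_, ht'.2.2⟩
  simp only [minimalTiles, Finset.mem_filter]
  refine ⟨ht'.1, ht'.2.1, fun t'' h1 h2 h3 h4 => ?_⟩
  have h5 := hmax t'' ⟨h1, h2, ht'.2.2.1.trans h3, h4.trans ht'.2.2.2⟩
  have hl : t''.l = t'.l := le_antisymm h5 (Tile.l_le_of_ω_subset h4)
  have hm := Tile.m_eq_of_ω_subset h4 hl
  have hn := Tile.n_eq_of_proj_subset hw h3 hl
  have hk := (hT _ h1).trans (hT _ ht'.1).symm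
  cases t''; cases t'; simp_all

theorem eq_of_mem_dense_of_le {w : ℝ} (hw : 0 < w) {u : ℝ → ℝ} {T : Finset Tile} {L : ℕ}
    {s t : Tile} (hs : s ∈ minimalTiles w T L) (ht : t ∈ minimalTiles w T L) (hst : s.l ≤ t.l)
    {x : ℝ} (hxs : x ∈ s.dense w u) (hxt : x ∈ t.dense w u) : t = s := by
  simp only [minimalTiles, Finset.mem_filter] at hs ht
  exact hs.2.2 t ht.1 ht.2.1 (Tile.proj_subset hw hst hxs.1 hxt.1)
    (Tile.ω_subset hst hxs.2 hxt.2)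

theorem pairwiseDisjoint_dense {w : ℝ} (hw : 0 < w) (u : ℝ → ℝ) (T : Finset Tile) (L : ℕ) :
    (minimalTiles w T L : Set Tile).PairwiseDisjoint (Tile.dense w u) := by
  intro s hs t ht hne
  refine Set.disjoint_left.2 fun x hxs hxt => hne ?_
  rcases le_total s.l t.l with h | h
  · exact (eq_of_mem_dense_of_le hw hs ht h hxs hxt).symm
  · exact eq_of_mem_dense_of_le hw ht hs h hxt hxs

/-- The Carleson packing condition for minimal tiles. -/
theorem sum_volume_proj_inter_le {w : ℝ} (hw : 0 < w) {u : ℝ → ℝ} (hu : Measurable u)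
    {T : Finset Tile} {A : ENNReal}
    (hA : ∀ t ∈ T, volume (t.proj w) ≤ A * volume (t.dense w u)) (s : Tile) :
    ∑ t ∈ minimalTiles w T s.l, volume (t.proj w ∩ s.proj w) ≤ A * volume (s.proj w) := by
  have h1 : ∀ t ∈ minimalTiles w T s.l,
      volume (t.proj w ∩ s.proj w) ≤ A * volume (t.dense w u ∩ s.proj w) := by
    intro t ht
    simp only [minimalTiles, Finset.mem_filter] at ht
    rcases (t.proj w ∩ s.proj w).eq_empty_or_nonempty with h | ⟨x, hx⟩
    · simp [h]
    · have hsub := Tile.proj_subset hw ht.2.1 hx.1 hx.2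
      have hsub' : t.dense w u ⊆ s.proj w := inter_subset_left.trans hsub
      rw [inter_eq_left.2 hsub, inter_eq_left.2 hsub']
      exact hA t ht.1
  calc _ ≤ ∑ t ∈ minimalTiles w T s.l, A * volume (t.dense w u ∩ s.proj w) :=
        Finset.sum_le_sum h1
    _ = A * volume (⋃ t ∈ minimalTiles w T s.l, t.dense w u ∩ s.proj w) := by
        rw [← Finset.mul_sum, measure_biUnion_finset]
        · exact (pairwiseDisjoint_dense hw u T s.l).mono fun t => inter_subset_left
        · exact fun t _ =>
            (Tile.measurableSet_dense w hu t).inter (Tile.measurableSet_proj w s)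
    _ ≤ _ := by
        gcongr
        exact iUnion₂_subset fun t _ => inter_subset_right

/-- John–Nirenberg type moment bounds for the counting function of minimal tiles. -/
theorem setLIntegral_minimalTiles_pow_le {w : ℝ} (hw : 0 < w) {u : ℝ → ℝ} (hu : Measurable u)
    {T : Finset Tile} {A : ENNReal}
    (hA : ∀ t ∈ T, volume (t.proj w) ≤ A * volume (t.dense w u)) (r : ℕ) (s : Tile) :
    ∫⁻ x in s.proj w,
        ((((minimalTiles w T s.l).filter fun t => x ∈ t.proj w).card : ℕ) : ENNReal) ^ r ≤
      (r.factorial : ENNReal) * A ^ r * volume (s.proj w) := by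
  induction r generalizing s with
  | zero => simp
  | succ r ih =>
    refine (setLIntegral_card_pow_succ_le volume _ (Tile.proj w) (Tile.measurableSet_proj w)
      Tile.l _ r).trans ?_
    have h : ∀ t ∈ minimalTiles w T s.l, ∫⁻ x in t.proj w ∩ s.proj w,
        (((((minimalTiles w T s.l).filter fun a => a.l ≤ t.l).filter
          fun a => x ∈ a.proj w).card : ℕ) : ENNReal) ^ r ≤
        (r.factorial : ENNReal) * A ^ r * volume (t.proj w ∩ s.proj w) := by
      intro t ht
      simp only [minimalTiles, Finset.mem_filter] at ht
      rcases (t.proj w ∩ s.proj w).eq_empty_or_nonempty with h | ⟨x, hx⟩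
      · simp [h]
      · rw [inter_eq_left.2 (Tile.proj_subset hw ht.2.1 hx.1 hx.2)]
        refine le_trans (lintegral_mono fun x => ?_) (ih t)
        gcongr
        exact filter_minimalTiles_subset w T ht.2.1
    calc _ ≤ ((r + 1 : ℕ) : ENNReal) * ∑ t ∈ minimalTiles w T s.l,
          (r.factorial : ENNReal) * A ^ r * volume (t.proj w ∩ s.proj w) := by
            gcongr with t ht
            exact h t ht
      _ ≤ ((r + 1 : ℕ) : ENNReal) * ((r.factorial : ENNReal) * A ^ r *
          (A * volume (s.proj w))) := by
            rw [← Finset.mul_sum]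
            gcongr
            exact sum_volume_proj_inter_le hw hu hA s
      _ = _ := by
            rw [Nat.factorial_succ, Nat.cast_mul, pow_succ]
            ring

theorem card_rect_le_card_minimalTiles {w : ℝ} (hw : 0 < w) {ℛ : Finset Tile}
    (hinc : ∀ R ∈ ℛ, ∀ R' ∈ ℛ, R ≠ R' → ¬ Tile.le w R R' ∧ ¬ Tile.le w R' R)
    (L : ℕ) (p : ℝ × ℝ) :
    ((ℛ.filter fun R => R.l ≤ L).filter fun R => p ∈ R.rect w).card ≤
      ((minimalTiles w (ℛ.image Tile.base) L).filter fun t => p.1 ∈ t.proj w).card := by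
  have hex : ∀ R : Tile, R ∈ ((ℛ.filter fun R => R.l ≤ L).filter fun R => p ∈ R.rect w) →
      ∃ t ∈ minimalTiles w (ℛ.image Tile.base) L, R.proj w ⊆ t.proj w ∧ t.ω ⊆ R.ω := by
    intro R hR
    simp only [Finset.mem_filter] at hR
    refine exists_minimalTiles (t := R.base) hw ?_ (Finset.mem_image_of_mem _ hR.1.1) hR.1.2
    intro t ht
    obtain ⟨R', -, rfl⟩ := Finset.mem_image.1 ht
    rfl
  choose! g hg using hex
  refine Finset.card_le_card_of_injOn g (fun R hR => ?_) (fun R hR R' hR' he => ?_)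
  · refine Finset.mem_coe.2 (Finset.mem_filter.2 ⟨(hg R hR).1, (hg R hR).2.1 ?_⟩)
    exact (Finset.mem_filter.1 hR).2.1
  · by_contra hne
    have h1 := (hg R hR).2.2 (Tile.slope_mem_ω _)
    have h2 := (hg R' hR').2.2 (Tile.slope_mem_ω _)
    rw [← he] at h2
    have hR := Finset.mem_filter.1 hR
    have hR' := Finset.mem_filter.1 hR'
    have hnot := hinc R (Finset.mem_filter.1 hR.1).1 R' (Finset.mem_filter.1 hR'.1).1 hne
    rcases le_total R.l R'.l with h | h
    · exact hnot.1 (Tile.le_of_mem_rect hw (Tile.ω_subset h h1 h2) hR.2 hR'.2)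
    · exact hnot.2 (Tile.le_of_mem_rect hw (Tile.ω_subset h h2 h1) hR'.2 hR.2)

/-- Moment bounds for the overlap of incomparable tiles. -/
theorem lintegral_card_rect_pow_le {w : ℝ} (hw : 0 < w) {u : ℝ → ℝ} (hu : Measurable u)
    {ℛ : Finset Tile} {A : ENNReal}
    (hinc : ∀ R ∈ ℛ, ∀ R' ∈ ℛ, R ≠ R' → ¬ Tile.le w R R' ∧ ¬ Tile.le w R' R)
    (hA : ∀ t ∈ ℛ, volume (t.proj w) ≤ A * volume (t.dense w u)) (r : ℕ) :
    ∫⁻ p : ℝ × ℝ, (((ℛ.filter fun R => p ∈ R.rect w).card : ℕ) : ENNReal) ^ (r + 1) ≤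
      ((r + 1).factorial : ENNReal) * A ^ r * ENNReal.ofReal (∑ R ∈ ℛ, R.area w) := by
  have hA' : ∀ t ∈ ℛ.image Tile.base, volume (t.proj w) ≤ A * volume (t.dense w u) := by
    intro t ht
    obtain ⟨R, hR, rfl⟩ := Finset.mem_image.1 ht
    exact hA R hR
  have h1 := setLIntegral_card_pow_succ_le (volume : Measure (ℝ × ℝ)) ℛ (Tile.rect w)
    (Tile.measurableSet_rect w) Tile.l univ r
  simp only [Measure.restrict_univ, inter_univ] at h1
  have h2 : ∀ R ∈ ℛ, ∫⁻ p in R.rect w,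
      ((((ℛ.filter fun s => s.l ≤ R.l).filter fun s => p ∈ s.rect w).card : ℕ) : ENNReal) ^ r ≤
      (r.factorial : ENNReal) * A ^ r * ENNReal.ofReal (R.area w) := by
    intro R _
    calc _ ≤ ∫⁻ p in R.rect w, ((((minimalTiles w (ℛ.image Tile.base) R.l).filter
            fun t => p.1 ∈ t.proj w).card : ℕ) : ENNReal) ^ r := by
          refine lintegral_mono fun p => ?_
          exact pow_le_pow_left' (Nat.cast_le.2 (card_rect_le_card_minimalTiles hw hinc R.l p)) r
      _ = ENNReal.ofReal w * ∫⁻ x in R.proj w, ((((minimalTiles w (ℛ.image Tile.base) R.l).filter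
            fun t => x ∈ t.proj w).card : ℕ) : ENNReal) ^ r :=
          Tile.setLIntegral_rect_fst w R
            ((measurable_card_filter_mem _ _ (Tile.measurableSet_proj w)).pow_const r)
      _ ≤ ENNReal.ofReal w * ((r.factorial : ENNReal) * A ^ r * volume (R.proj w)) := by
          gcongr
          exact setLIntegral_minimalTiles_pow_le hw hu hA' r R
      _ = (r.factorial : ENNReal) * A ^ r * (ENNReal.ofReal w * ENNReal.ofReal (R.len w)) := by
          rw [Tile.volume_proj]; ring
      _ = _ := by
          rw [← ENNReal.ofReal_mul hw.le]
          congr 2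
          unfold Tile.len Tile.area
          ring
  refine h1.trans ?_
  calc _ ≤ ((r + 1 : ℕ) : ENNReal) * ∑ R ∈ ℛ,
        (r.factorial : ENNReal) * A ^ r * ENNReal.ofReal (R.area w) := by
          gcongr with R hR
          exact h2 R hR
    _ = _ := by
          rw [← Finset.mul_sum, ENNReal.ofReal_sum_of_nonneg, Nat.factorial_succ, Nat.cast_mul]
          · ring
          · intro R _
            unfold Tile.area
            positivity

theorem volume_proj_le_dense {w : ℝ} (hw : 0 < w) {u : ℝ → ℝ} (hu : Measurable u)
    {E : Set (ℝ × ℝ)} {δ : ℝ} (hδ : 0 < δ) {R : Tile}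
    (h : δ * R.area w ≤ (volume (E ∩ {p : ℝ × ℝ | u p.1 ∈ R.ω} ∩ R.rect w)).toReal) :
    volume (R.proj w) ≤ ENNReal.ofReal δ⁻¹ * volume (R.dense w u) := by
  have hmeas : MeasurableSet (u ⁻¹' R.ω) := hu measurableSet_Ico
  have h1 : volume (E ∩ {p : ℝ × ℝ | u p.1 ∈ R.ω} ∩ R.rect w) ≤
      ENNReal.ofReal w * volume (R.dense w u) := by
    calc _ ≤ volume ({p : ℝ × ℝ | u p.1 ∈ R.ω} ∩ R.rect w) := by
          gcongr
          exact inter_subset_right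
      _ = ∫⁻ p in R.rect w, (u ⁻¹' R.ω).indicator (fun _ => (1 : ENNReal)) p.1 := by
          have hm : MeasurableSet {p : ℝ × ℝ | u p.1 ∈ R.ω} := measurable_fst hmeas
          rw [← Measure.restrict_apply hm, ← lintegral_indicator_one hm]
          rfl
      _ = _ := by
          rw [Tile.setLIntegral_rect_fst w R (measurable_const.indicator hmeas),
            lintegral_indicator hmeas, setLIntegral_one, Measure.restrict_apply hmeas, inter_comm]
          rfl
  have h2 := (ENNReal.ofReal_le_of_le_toReal h).trans h1
  have h3 : ENNReal.ofReal (δ * R.area w) =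
      ENNReal.ofReal w * (ENNReal.ofReal δ * volume (R.proj w)) := by
    rw [Tile.volume_proj, ← ENNReal.ofReal_mul hδ.le, ← ENNReal.ofReal_mul hw.le]
    congr 1
    unfold Tile.area Tile.len
    ring
  rw [h3, ENNReal.mul_le_mul_iff_right (by simpa using hw) ENNReal.ofReal_ne_top] at h2
  calc volume (R.proj w) = ENNReal.ofReal δ⁻¹ * (ENNReal.ofReal δ * volume (R.proj w)) := by
        rw [← mul_assoc, ← ENNReal.ofReal_mul (by positivity), inv_mul_cancel₀ hδ.ne']
        simp
    _ ≤ _ := by gcongr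

theorem natCast_le_add_pow (n r : ℕ) {t : ℝ} (ht : 0 < t) :
    (n : ENNReal) ≤ ENNReal.ofReal t + ENNReal.ofReal (t⁻¹ ^ r) * (n : ENNReal) ^ (r + 1) := by
  have h : (n : ℝ) ≤ t + t⁻¹ ^ r * (n : ℝ) ^ (r + 1) := by
    rcases le_total (n : ℝ) t with h | h
    · have : 0 ≤ t⁻¹ ^ r * (n : ℝ) ^ (r + 1) := by positivity
      linarith
    · have h1 : 1 ≤ t⁻¹ * n := by
        rw [inv_mul_eq_div]
        exact (one_le_div ht).2 h
      have h2 : (n : ℝ) ≤ (t⁻¹ * n) ^ r * n :=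
        le_mul_of_one_le_left n.cast_nonneg (one_le_pow₀ h1)
      have h3 : (t⁻¹ * n) ^ r * n = t⁻¹ ^ r * (n : ℝ) ^ (r + 1) := by ring
      linarith
  rw [← ENNReal.ofReal_natCast, ← ENNReal.ofReal_pow n.cast_nonneg,
    ← ENNReal.ofReal_mul (by positivity), ← ENNReal.ofReal_add ht.le (by positivity)]
  exact ENNReal.ofReal_le_ofReal h

/-- the maximal lemma. -/
theorem maximal_lemma (ε : ℝ) (hε : 0 < ε) :
    ∃ C : ℝ, 0 < C ∧
      ∀ (w : ℝ), 0 < w →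
      ∀ (u : ℝ → ℝ), Measurable u → (∀ x, |u x| ≤ 1) →
      ∀ (E F : Set (ℝ × ℝ)), MeasurableSet E → MeasurableSet F →
      ∀ (δ lam : ℝ), δ ∈ Ioc (0:ℝ) 1 → lam ∈ Ioc (0:ℝ) 1 →
      ∀ ℛ : Finset Tile,
        (∀ R ∈ ℛ, ∀ R' ∈ ℛ, R ≠ R' → ¬ Tile.le w R R' ∧ ¬ Tile.le w R' R) →
        (∀ R ∈ ℛ, δ * R.area w ≤
            (volume (E ∩ {p : ℝ × ℝ | u p.1 ∈ R.ω} ∩ R.rect w)).toReal) →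
        (∀ R ∈ ℛ, lam * R.area w ≤ (volume (F ∩ R.rect w)).toReal) →
        ENNReal.ofReal (∑ R ∈ ℛ, R.area w) ≤
          ENNReal.ofReal C * volume F /
            (ENNReal.ofReal δ * ENNReal.ofReal (lam ^ (1 + ε))) := by
  obtain ⟨r, hr⟩ : ∃ r : ℕ, 1 ≤ ε * r := by
    obtain ⟨r, hr⟩ := exists_nat_ge (1 / ε)
    exact ⟨r, by rwa [div_le_iff₀ hε, mul_comm] at hr⟩
  have hr0 : r ≠ 0 := by
    rintro rfl
    norm_num at hr
  set D : ℝ := 2 * ((r + 1).factorial : ℝ) with hDdef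
  have hfac : (1:ℝ) ≤ ((r + 1).factorial : ℝ) := by exact_mod_cast (r + 1).factorial_pos
  have hD : 1 ≤ D := by linarith
  refine ⟨2 * D, by linarith, ?_⟩
  rintro w hw u hu - E F - hF δ lam ⟨hδ, -⟩ ⟨hlam, hlam1⟩ ℛ hinc hE hFR
  have hpow : 0 < lam ^ (1 + ε) := Real.rpow_pos_of_pos hlam _
  by_cases htop : volume F = ⊤
  · rw [htop, ENNReal.mul_top (by simp; linarith), ENNReal.top_div_of_ne_top]
    · exact le_top
    · exact ENNReal.mul_ne_top ENNReal.ofReal_ne_top ENNReal.ofReal_ne_top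
  set S : ℝ := ∑ R ∈ ℛ, R.area w with hS
  have hS0 : 0 ≤ S := Finset.sum_nonneg fun R _ => by unfold Tile.area; positivity
  set V : ℝ := (volume F).toReal
  have hV0 : 0 ≤ V := ENNReal.toReal_nonneg
  have hVF : volume F = ENNReal.ofReal V := (ENNReal.ofReal_toReal htop).symm
  have hlamε : 0 < lam ^ ε := Real.rpow_pos_of_pos hlam _
  set t : ℝ := D * δ⁻¹ * (lam ^ ε)⁻¹ with htdef
  have ht : 0 < t := by positivity
  have hmoment := lintegral_card_rect_pow_le hw hu hinc
    (fun R hR => volume_proj_le_dense hw hu hδ (hE R hR)) r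
  have hlower : ENNReal.ofReal (lam * S) ≤
      ∫⁻ p in F, (((ℛ.filter fun R => p ∈ R.rect w).card : ℕ) : ENNReal) := by
    simp_rw [card_filter_mem_eq_sum_indicator]
    rw [lintegral_finsetSum _ fun R _ =>
      measurable_const.indicator (Tile.measurableSet_rect w R), hS, Finset.mul_sum,
      ENNReal.ofReal_sum_of_nonneg fun R _ => by unfold Tile.area; positivity]
    refine Finset.sum_le_sum fun R hR => ?_
    rw [lintegral_indicator (Tile.measurableSet_rect w R), setLIntegral_one,
      Measure.restrict_apply (Tile.measurableSet_rect w R), inter_comm]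
    exact ENNReal.ofReal_le_of_le_toReal (hFR R hR)
  have hupper : ENNReal.ofReal (lam * S) ≤ ENNReal.ofReal
      (t * V + t⁻¹ ^ r * (((r + 1).factorial : ℝ) * δ⁻¹ ^ r * S)) := by
    calc _ ≤ _ := hlower
      _ ≤ ∫⁻ p in F, (ENNReal.ofReal t + ENNReal.ofReal (t⁻¹ ^ r) *
            (((ℛ.filter fun R => p ∈ R.rect w).card : ℕ) : ENNReal) ^ (r + 1)) :=
          lintegral_mono fun p => natCast_le_add_pow _ r ht
      _ = ENNReal.ofReal t * volume F + ENNReal.ofReal (t⁻¹ ^ r) * ∫⁻ p in F,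
            (((ℛ.filter fun R => p ∈ R.rect w).card : ℕ) : ENNReal) ^ (r + 1) := by
          rw [lintegral_add_left measurable_const, setLIntegral_const, lintegral_const_mul]
          exact (measurable_card_filter_mem _ _ (Tile.measurableSet_rect w)).pow_const _
      _ ≤ ENNReal.ofReal t * volume F + ENNReal.ofReal (t⁻¹ ^ r) *
            (((r + 1).factorial : ENNReal) * ENNReal.ofReal δ⁻¹ ^ r * ENNReal.ofReal S) := by
          gcongr
          exact (setLIntegral_le_lintegral _ _).trans hmoment
      _ = _ := by
          have ht' : 0 ≤ t⁻¹ ^ r := by positivity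
          have hδ' : 0 ≤ ((r + 1).factorial : ℝ) * δ⁻¹ ^ r := by positivity
          rw [hVF, ENNReal.ofReal_add (by positivity) (by positivity), ENNReal.ofReal_mul ht.le,
            ENNReal.ofReal_mul ht', ENNReal.ofReal_mul hδ', ENNReal.ofReal_mul (Nat.cast_nonneg _),
            ENNReal.ofReal_natCast, ENNReal.ofReal_pow (inv_nonneg.2 hδ.le)]
  have hreal := (ENNReal.ofReal_le_ofReal_iff (by positivity)).1 hupper
  have hsmall : t⁻¹ ^ r * (((r + 1).factorial : ℝ) * δ⁻¹ ^ r) ≤ lam / 2 := by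
    have h1 : (lam ^ ε) ^ r ≤ lam := by
      rw [← Real.rpow_natCast, ← Real.rpow_mul hlam.le]
      calc lam ^ (ε * r) ≤ lam ^ (1:ℝ) := Real.rpow_le_rpow_of_exponent_ge hlam hlam1 hr
        _ = lam := Real.rpow_one _
    have h2 : t⁻¹ ^ r * (((r + 1).factorial : ℝ) * δ⁻¹ ^ r) =
        (((r + 1).factorial : ℝ) / D ^ r) * (lam ^ ε) ^ r := by
      rw [htdef, mul_inv, mul_inv, inv_inv, inv_inv, mul_pow, mul_pow, inv_pow, inv_pow]
      field_simp
    have h3 : ((r + 1).factorial : ℝ) / D ^ r ≤ 1 / 2 := by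
      rw [div_le_iff₀ (by positivity)]
      have := le_self_pow₀ hD hr0
      linarith
    rw [h2]
    calc _ ≤ 1 / 2 * lam := by gcongr
      _ = _ := by ring
  have hfinal : S ≤ 2 * D * V / (δ * lam ^ (1 + ε)) := by
    have h1 : lam * S ≤ t * V + lam / 2 * S := by
      have := mul_le_mul_of_nonneg_right hsmall hS0
      linarith
    rw [le_div_iff₀ (by positivity), Real.rpow_add hlam, Real.rpow_one]
    have h2 : δ * lam ^ ε * (lam * S) ≤ δ * lam ^ ε * (2 * (t * V)) :=
      mul_le_mul_of_nonneg_left (by linarith) (by positivity)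
    have h3 : δ * lam ^ ε * (2 * (t * V)) = 2 * D * V := by
      rw [htdef]
      field_simp
    linarith
  rw [hVF, ← ENNReal.ofReal_mul (by positivity), ← ENNReal.ofReal_mul hδ.le,
    ← ENNReal.ofReal_div_of_pos (by positivity)]
  exact ENNReal.ofReal_le_ofReal hfinal

end Bateman
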